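/- Let p(y) be a probability density on ℝ^M, and let q_a(x, y), q_b(x, y) be strictly positive joint probability densities on ℝ^N × ℝ^M with marginals q_a(y), q_b(y) and conditional q_b(x | y) = q_b(x, y)/q_b(y). Assume all displayed integrals converge. If the EM improvement condition holds, namely ∫ p(y) ∫ q_b(x | y) log q_a(x, y) dx dy ≥ ∫ p(y) ∫ q_b(x | y) log q_b(x, y) dx dy, then the expected log-evidence does not decrease: ∫ p(y) log q_a(y) dy ≥ ∫ p(y) log q_b(y) dy. (Monotonicity of the expectation-maximization update.) -/

import Mathlib

open MeasureTheory

/-- The **Gibbs inequality** for unnormalized positive densities `f` and `g`. -/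
theorem integral_div_mul_log_sub_le_log_integral_sub {α : Type*} [MeasurableSpace α]
    {μ : Measure α} {f g : α → ℝ} (hf : Integrable f μ) (hg : Integrable g μ)
    (hf_pos : ∀ x, 0 < f x) (hg_pos : ∀ x, 0 < g x)
    (hA : 0 < ∫ x, f x ∂μ) (hB : 0 < ∫ x, g x ∂μ)
    (hgf : Integrable (fun x => (g x / ∫ x', g x' ∂μ) * Real.log (f x)) μ)
    (hgg : Integrable (fun x => (g x / ∫ x', g x' ∂μ) * Real.log (g x)) μ) :
    (∫ x, (g x / ∫ x', g x' ∂μ) * Real.log (f x) ∂μ)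
        - ∫ x, (g x / ∫ x', g x' ∂μ) * Real.log (g x) ∂μ
      ≤ Real.log (∫ x, f x ∂μ) - Real.log (∫ x, g x ∂μ) := by
  set A := ∫ x, f x ∂μ with hAdef
  set B := ∫ x, g x ∂μ with hBdef
  have pointwise : ∀ x, g x / B * Real.log (f x) - g x / B * Real.log (g x)
      ≤ g x / B * (Real.log A - Real.log B) + (f x / A - g x / B) := by
    intro x
    have hfA : 0 < f x / A := div_pos (hf_pos x) hA
    have hgB : 0 < g x / B := div_pos (hg_pos x) hB
    have hlog := Real.log_le_sub_one_of_pos (div_pos hfA hgB)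
    rw [Real.log_div hfA.ne' hgB.ne', Real.log_div (hf_pos x).ne' hA.ne',
      Real.log_div (hg_pos x).ne' hB.ne'] at hlog
    have hmul := mul_le_mul_of_nonneg_left hlog hgB.le
    rw [mul_sub (g x / B) (f x / A / (g x / B)), mul_div_cancel₀ _ hgB.ne'] at hmul
    linarith
  have hgB : Integrable (fun x => g x / B * (Real.log A - Real.log B)) μ :=
    (hg.div_const B).mul_const _
  have hdiff : Integrable (fun x => f x / A - g x / B) μ :=
    (hf.div_const A).sub (hg.div_const B)
  have hint := integral_mono (hgf.sub hgg) (hgB.add hdiff) pointwise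
  simp only [Pi.sub_apply, Pi.add_apply] at hint
  rw [integral_sub hgf hgg, integral_add hgB hdiff,
    integral_sub (hf.div_const A) (hg.div_const B), integral_mul_const,
    integral_div, integral_div, ← hAdef, ← hBdef, div_self hA.ne', div_self hB.ne'] at hint
  linarith

theorem integral_pos_of_forall_pos {α : Type*} [MeasurableSpace α] {μ : Measure α} [NeZero μ]
    {f : α → ℝ} (hf : Integrable f μ) (hf_pos : ∀ x, 0 < f x) : 0 < ∫ x, f x ∂μ := by
  rw [integral_pos_iff_support_of_nonneg (fun x => (hf_pos x).le) hf,
    Function.support_eq_univ (fun x => (hf_pos x).ne')]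
  exact Measure.measure_univ_pos.2 (NeZero.ne μ)

/-- **Monotonicity of the expectation-maximization update.** Let `p` be a probability density
of observations on `ℝ^M` and `qa`, `qb` strictly positive joint probability densities on
`ℝ^N × ℝ^M`. If the EM improvement condition
`∫ p(y) ∫ qb(x|y) log qa(x,y) dx dy ≥ ∫ p(y) ∫ qb(x|y) log qb(x,y) dx dy` holds, then the
expected log-evidence does not decrease: `∫ p(y) log qa(y) dy ≥ ∫ p(y) log qb(y) dy`. -/
theorem em_update_monotone
    {N M : ℕ}
    (p : EuclideanSpace ℝ (Fin M) → ℝ)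
    (hp_meas : Measurable p)
    (hp_nonneg : ∀ y, 0 ≤ p y)
    (hp_prob : ∫ y, p y = 1)
    (qa qb : EuclideanSpace ℝ (Fin N) → EuclideanSpace ℝ (Fin M) → ℝ)
    (hqa_meas : Measurable fun q : EuclideanSpace ℝ (Fin N) × EuclideanSpace ℝ (Fin M) =>
      qa q.1 q.2)
    (hqb_meas : Measurable fun q : EuclideanSpace ℝ (Fin N) × EuclideanSpace ℝ (Fin M) =>
      qb q.1 q.2)
    (hqa_pos : ∀ x y, 0 < qa x y) (hqb_pos : ∀ x y, 0 < qb x y)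
    (hqa_prob : ∫ y, ∫ x, qa x y = 1) (hqb_prob : ∫ y, ∫ x, qb x y = 1)
    -- the displayed integrals converge:
    (hIa : ∀ y, Integrable fun x => qa x y)
    (hIb : ∀ y, Integrable fun x => qb x y)
    (hI1 : ∀ y, Integrable fun x => (qb x y / ∫ x', qb x' y) * Real.log (qa x y))
    (hI2 : ∀ y, Integrable fun x => (qb x y / ∫ x', qb x' y) * Real.log (qb x y))
    (hO1 : Integrable fun y =>
      p y * ∫ x, (qb x y / ∫ x', qb x' y) * Real.log (qa x y))
    (hO2 : Integrable fun y =>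
      p y * ∫ x, (qb x y / ∫ x', qb x' y) * Real.log (qb x y))
    (hOma : Integrable fun y => p y * Real.log (∫ x, qa x y))
    (hOmb : Integrable fun y => p y * Real.log (∫ x, qb x y))
    -- the EM improvement condition:
    (hEM : (∫ y, p y * ∫ x, (qb x y / ∫ x', qb x' y) * Real.log (qa x y))
      ≥ ∫ y, p y * ∫ x, (qb x y / ∫ x', qb x' y) * Real.log (qb x y)) :
    (∫ y, p y * Real.log (∫ x, qa x y)) ≥ ∫ y, p y * Real.log (∫ x, qb x y) := by
  have gibbs : ∀ y,
      p y * (∫ x, (qb x y / ∫ x', qb x' y) * Real.log (qa x y))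
          - p y * (∫ x, (qb x y / ∫ x', qb x' y) * Real.log (qb x y))
        ≤ p y * Real.log (∫ x, qa x y) - p y * Real.log (∫ x, qb x y) := by
    intro y
    rw [← mul_sub, ← mul_sub]
    exact mul_le_mul_of_nonneg_left
      (integral_div_mul_log_sub_le_log_integral_sub (hIa y) (hIb y)
        (fun x => hqa_pos x y) (fun x => hqb_pos x y)
        (integral_pos_of_forall_pos (hIa y) fun x => hqa_pos x y)
        (integral_pos_of_forall_pos (hIb y) fun x => hqb_pos x y) (hI1 y) (hI2 y))
      (hp_nonneg y)
  have hint := integral_mono (hO1.sub hO2) (hOma.sub hOmb) gibbs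
  simp only [Pi.sub_apply] at hint
  rw [integral_sub hO1 hO2, integral_sub hOma hOmb] at hint
  linarith
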